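/- arXiv:1904.13360 — 2 statements merged into one kernel-verified Lean document; each statement's English description precedes it below -/
import Mathlib

section
/- For every POMDP Γ, every initial belief p₁ ∈ Δ(K), and every strategy σ with finite memory, the sequence of average rewards (1/n) Σ_{m=1}^n g_m converges P^{p₁}_σ-almost surely as n → ∞. -/
open MeasureTheory Filter

namespace PomdpPaper

/-- A belief (probability vector) on `Fin n`. -/
def IsBelief {n : ℕ} (p : Fin n → ℝ) : Prop :=
  (∀ k, 0 ≤ p k) ∧ ∑ k, p k = 1

/-- The measure on a finite type associated with a probability vector. -/
noncomputable def vecMeasure {α : Type*} [Fintype α] [MeasurableSpace α] (p : α → ℝ) :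
    Measure α :=
  ∑ x : α, ENNReal.ofReal (p x) • Measure.dirac x

/-- The Dirac belief at a point. -/
def diracBelief {n : ℕ} (k : Fin n) : Fin n → ℝ := fun k' => if k' = k then 1 else 0

/-- The `i`-th binary digit of a real number `x ∈ [0,1)` (as a real number `0` or `1`). -/
noncomputable def digitR (x : ℝ) (i : ℕ) : ℝ :=
  if ⌊x * 2 ^ (i + 1)⌋ % 2 = 1 then 1 else 0

/-- From one uniform seed `x ∈ [0,1)`, a sequence `unif x 0, unif x 1, …` of
(independent, uniformly distributed on `[0,1]`) real numbers, obtained by splitting the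
binary digits of `x` along the pairing function. -/
noncomputable def unif (x : ℝ) (m : ℕ) : ℝ :=
  ∑' j : ℕ, digitR x (Nat.pair m j) / 2 ^ (j + 1)

open Classical in
/-- Inverse-transform sampling from a probability vector on `Fin n` using a seed `u ∈ [0,1]`. -/
noncomputable def sampleFin {n : ℕ} (hn : 0 < n) (p : Fin n → ℝ) (u : ℝ) : Fin n :=
  let s : Finset (Fin n) :=
    Finset.univ.filter fun y : Fin n => u < ∑ z ∈ Finset.univ.filter fun z : Fin n => z ≤ y, p z
  if hs : s.Nonempty then s.min' hs else ⟨0, hn⟩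

/-- Inverse-transform sampling from a probability vector on a finite nonempty type. -/
noncomputable def sampleOn {β : Type*} [Fintype β] [Nonempty β] (p : β → ℝ) (u : ℝ) : β :=
  (Fintype.equivFin β).symm
    (sampleFin Fintype.card_pos (fun i => p ((Fintype.equivFin β).symm i)) u)

/-- A POMDP with states `Fin nK`, actions `Fin nA`, signals `Fin nS`, transition function `q`
and reward function `g` with values in `[0,1]`. -/
structure POMDP where
  nK : ℕ
  nA : ℕ
  nS : ℕ
  hK : 0 < nK
  hA : 0 < nA
  hS : 0 < nS
  q : Fin nK → Fin nA → Fin nK × Fin nS → ℝ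
  q_nonneg : ∀ k a y, 0 ≤ q k a y
  q_sum : ∀ k a, ∑ y, q k a y = 1
  g : Fin nK → Fin nA → ℝ
  g_nonneg : ∀ k a, 0 ≤ g k a
  g_le_one : ∀ k a, g k a ≤ 1

namespace POMDP

variable (Γ : POMDP)

/-- The state space. -/
abbrev K := Fin Γ.nK
/-- The action space. -/
abbrev A := Fin Γ.nA
/-- The signal space. -/
abbrev S := Fin Γ.nS

instance : Nonempty Γ.K := ⟨⟨0, Γ.hK⟩⟩
instance : Nonempty Γ.A := ⟨⟨0, Γ.hA⟩⟩
instance : Nonempty Γ.S := ⟨⟨0, Γ.hS⟩⟩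

/-- A history: the finite sequence of past actions and signals. -/
abbrev Hist := List (Γ.A × Γ.S)

/-- A (pure) strategy: a map from histories to actions. -/
abbrev Strategy := Γ.Hist → Γ.A

/-- The sample space carrying all the randomness: an initial state together with a
uniform seed in `[0,1)` used to draw all the transitions. -/
abbrev Env := Γ.K × ℝ

/-- The probability measure on the sample space induced by the initial belief `p1`:
the initial state is drawn according to `p1`, the seed uniformly on `[0,1)`. -/
noncomputable def envMeasure (p1 : Γ.K → ℝ) : Measure Γ.Env :=
  (vecMeasure p1).prod (volume.restrict (Set.Ico (0 : ℝ) 1))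

/-- The trajectory: `(Γ.traj σ ω m).1` is the state `k_{m+1}` at stage `m+1` and
`(Γ.traj σ ω m).2` is the history before stage `m+1` (of length `m`), when the
decision-maker uses strategy `σ` and the randomness is `ω`.  At each stage, the pair
(new state, signal) is drawn from `q` via inverse-transform sampling from a fresh
uniform variable. -/
noncomputable def traj (σ : Γ.Strategy) (ω : Γ.Env) : ℕ → Γ.K × Γ.Hist
  | 0 => (ω.1, [])
  | m + 1 =>
    let p := traj σ ω m
    let a := σ p.2
    let y := sampleOn (Γ.q p.1 a) (unif ω.2 m)
    (y.1, p.2 ++ [(a, y.2)])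

/-- The state `k_{m+1}` at stage `m+1` (`m` is 0-indexed). -/
noncomputable def state (σ : Γ.Strategy) (ω : Γ.Env) (m : ℕ) : Γ.K := (Γ.traj σ ω m).1

/-- The history before stage `m+1` (a list of length `m`). -/
noncomputable def hist (σ : Γ.Strategy) (ω : Γ.Env) (m : ℕ) : Γ.Hist := (Γ.traj σ ω m).2

/-- The action `a_{m+1}` played at stage `m+1`. -/
noncomputable def act (σ : Γ.Strategy) (ω : Γ.Env) (m : ℕ) : Γ.A := σ (Γ.hist σ ω m)

/-- The reward `g_{m+1}` obtained at stage `m+1`. -/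
noncomputable def rew (σ : Γ.Strategy) (ω : Γ.Env) (m : ℕ) : ℝ :=
  Γ.g (Γ.state σ ω m) (Γ.act σ ω m)

/-- The average reward over the first `n` stages. -/
noncomputable def avg (σ : Γ.Strategy) (ω : Γ.Env) (n : ℕ) : ℝ :=
  (1 / n : ℝ) * ∑ m ∈ Finset.range n, Γ.rew σ ω m

/-- The probability of an event under initial belief `p1` (the strategy `σ` is recorded for
readability; the underlying measure does not depend on it). -/
noncomputable def prob (p1 : Γ.K → ℝ) (_σ : Γ.Strategy) (E : Set Γ.Env) : ℝ :=
  (Γ.envMeasure p1 E).toReal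

/-- The long-run average payoff `γ^{p1}_∞(σ) = E[liminf (1/n) ∑ g_m]`. -/
noncomputable def pay (p1 : Γ.K → ℝ) (σ : Γ.Strategy) : ℝ :=
  ∫ ω, atTop.liminf (Γ.avg σ ω) ∂(Γ.envMeasure p1)

/-- The payoff starting from a deterministic state `k`, i.e. `γ^k_∞(σ)`. -/
noncomputable def payK (k : Γ.K) (σ : Γ.Strategy) : ℝ := Γ.pay (diracBelief k) σ

/-- The value `v_∞(p1)`. -/
noncomputable def val (p1 : Γ.K → ℝ) : ℝ := ⨆ σ : Γ.Strategy, Γ.pay p1 σ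

/-- A strategy has finite memory if it is implemented by a finite-state transducer. -/
def FiniteMemory (σ : Γ.Strategy) : Prop :=
  ∃ (n : ℕ) (m0 : Fin n) (σa : Fin n → Γ.A) (σu : Fin n → Γ.A × Γ.S → Fin n),
    ∀ h : Γ.Hist, σ h = σa (h.foldl σu m0)

/-- A blind MDP: the signal set is a singleton. -/
def Blind : Prop := Γ.nS = 1

/-- The strategy induced by a sequence of actions `a_1, a_2, …` (`as m` is the action played
at stage `m+1`, regardless of the observed history). -/
def blindStrat (as : ℕ → Γ.A) : Γ.Strategy := fun h => as h.length

end POMDP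

/-- A sequence is eventually periodic if it is periodic with some period `T ≥ 1` from
some stage `N` on. -/
def EventuallyPeriodic {α : Type*} (as : ℕ → α) : Prop :=
  ∃ T ≥ 1, ∃ N ≥ 1, ∀ m ≥ N, as (m + T) = as m


section Digits

/-- The event that the `i`-th digit is one. -/
def Dset (i : ℕ) : Set ℝ := {x | ⌊x * 2 ^ (i + 1)⌋ % 2 = 1}

lemma measurableSet_Dset (i : ℕ) : MeasurableSet (Dset i) := by
  have h : Measurable fun x : ℝ => ⌊x * 2 ^ (i + 1)⌋ :=
    Int.measurable_floor.comp (measurable_id.mul_const _)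
  exact h (MeasurableSet.of_discrete (s := {n : ℤ | n % 2 = 1}))

lemma floor_pow (x : ℝ) {j a : ℕ} (h : j ≤ a) :
    ⌊x * 2 ^ j⌋ = ⌊x * 2 ^ a⌋ / 2 ^ (a - j) := by
  have := Int.floor_div_natCast (x * 2 ^ a) (2 ^ (a - j))
  push_cast at this
  rw [← this]
  congr 1
  rw [eq_div_iff (by positivity), mul_assoc, ← pow_add]
  congr 2
  omega

lemma even_succ_div (N : ℤ) (hN : N % 2 = 0) {k : ℕ} (hk : 1 ≤ k) :
    (N + 1) / 2 ^ k = N / 2 ^ k := by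
  obtain ⟨l, rfl⟩ : ∃ l, k = l + 1 := ⟨k - 1, by omega⟩
  rw [pow_succ', ← Int.ediv_ediv_of_nonneg (by norm_num), ← Int.ediv_ediv_of_nonneg (by norm_num)]
  congr 1
  omega

lemma mem_E_iff (s : Finset ℕ) (a : ℕ) (h : ∀ i ∈ s, i < a) (x : ℝ) :
    x ∈ (⋂ i ∈ s, Dset i) ∩ Set.Ico (0 : ℝ) 1 ↔
      (∀ i ∈ s, (⌊x * 2 ^ (a + 1)⌋ / 2 ^ (a - i)) % 2 = 1) ∧
        ⌊x * 2 ^ (a + 1)⌋ / 2 ^ (a + 1) = 0 := by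
  have h0 : x ∈ Set.Ico (0 : ℝ) 1 ↔ ⌊x * 2 ^ (a + 1)⌋ / 2 ^ (a + 1) = 0 := by
    have := floor_pow x (Nat.zero_le (a + 1))
    simp only [pow_zero, mul_one, Nat.sub_zero] at this
    rw [← this, Int.floor_eq_zero_iff]
  rw [Set.mem_inter_iff, h0]
  refine and_congr_left fun _ => ?_
  simp only [Set.mem_iInter]
  refine forall₂_congr fun i hi => ?_
  have := floor_pow x (show i + 1 ≤ a + 1 by have := h i hi; omega)
  rw [show a + 1 - (i + 1) = a - i by omega] at this
  rw [← this]
  rfl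

lemma key_half (s : Finset ℕ) (a : ℕ) (h : ∀ i ∈ s, i < a) :
    (volume.restrict (Set.Ico (0 : ℝ) 1)) (⋂ i ∈ insert a s, Dset i) =
      2⁻¹ * (volume.restrict (Set.Ico (0 : ℝ) 1)) (⋂ i ∈ s, Dset i) := by
  have hm : ∀ t : Finset ℕ, MeasurableSet (⋂ i ∈ t, Dset i) := fun t =>
    Finset.measurableSet_biInter t fun i _ => measurableSet_Dset i
  rw [Measure.restrict_apply (hm _), Measure.restrict_apply (hm _)]
  set E := (⋂ i ∈ s, Dset i) ∩ Set.Ico (0 : ℝ) 1 with hE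
  have e1 : (⋂ i ∈ insert a s, Dset i) ∩ Set.Ico (0 : ℝ) 1 = E ∩ Dset a := by
    rw [Finset.set_biInter_insert, hE]
    ext x; simp only [Set.mem_inter_iff]; tauto
  rw [e1]
  have e2 : (fun x => x + ((2 : ℝ) ^ (a + 1))⁻¹) ⁻¹' (E ∩ Dset a) = E \ Dset a := by
    ext x
    have hN : ⌊(x + ((2 : ℝ) ^ (a + 1))⁻¹) * 2 ^ (a + 1)⌋ = ⌊x * 2 ^ (a + 1)⌋ + 1 := by
      rw [add_mul, inv_mul_cancel₀ (by positivity), Int.floor_add_one]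
    rw [Set.mem_preimage, Set.mem_inter_iff, Set.mem_sdiff, hE, mem_E_iff s a h, mem_E_iff s a h]
    simp only [Dset, Set.mem_ofPred_eq, hN]
    generalize ⌊x * 2 ^ (a + 1)⌋ = N
    by_cases hp : N % 2 = 0
    · rw [even_succ_div N hp (by omega)]
      have : ∀ i ∈ s, ((N + 1) / 2 ^ (a - i)) = (N / 2 ^ (a - i)) := fun i hi =>
        even_succ_div N hp (by have := h i hi; omega)
      have e3 : (∀ i ∈ s, ((N + 1) / 2 ^ (a - i)) % 2 = 1) ↔ (∀ i ∈ s, (N / 2 ^ (a - i)) % 2 = 1) :=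
        forall₂_congr fun i hi => by rw [this i hi]
      rw [e3]
      have h1 : (N + 1) % 2 = 1 := by omega
      have h2 : ¬ N % 2 = 1 := by omega
      tauto
    · have h1 : ¬ (N + 1) % 2 = 1 := by omega
      have h2 : N % 2 = 1 := by omega
      tauto
  have e4 : volume (E ∩ Dset a) = volume (E \ Dset a) := by
    rw [← e2, measure_preimage_add_right]
  have e5 := measure_inter_add_sdiff (μ := volume) E (measurableSet_Dset a)
  rw [← e4, ← two_mul] at e5
  rw [← e5, ← mul_assoc, ENNReal.inv_mul_cancel (by norm_num) (by norm_num), one_mul]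

instance : IsProbabilityMeasure (volume.restrict (Set.Ico (0 : ℝ) 1)) :=
  ⟨by simp⟩

lemma meas_inter (s : Finset ℕ) :
    (volume.restrict (Set.Ico (0 : ℝ) 1)) (⋂ i ∈ s, Dset i) = 2⁻¹ ^ s.card := by
  induction s using Finset.induction_on_max with
  | empty => simp
  | insert a s hs ih =>
    rw [key_half s a hs, ih, Finset.card_insert_of_notMem (fun h => lt_irrefl _ (hs a h)),
      pow_succ']

lemma meas_Dset (i : ℕ) : (volume.restrict (Set.Ico (0 : ℝ) 1)) (Dset i) = 2⁻¹ := by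
  simpa using meas_inter {i}

lemma digit_eq (i : ℕ) : (fun x => digitR x i) = (Dset i).indicator fun _ => (1 : ℝ) := by
  ext x
  simp only [digitR, Set.indicator, Dset, Set.mem_ofPred_eq]
  congr

lemma measurable_digit (i : ℕ) : Measurable fun x => digitR x i := by
  rw [digit_eq]
  exact measurable_const.indicator (measurableSet_Dset i)

lemma iIndep_digit : ProbabilityTheory.iIndepFun (fun i x => digitR x i)
    (volume.restrict (Set.Ico (0 : ℝ) 1)) := by
  have : (fun i x => digitR x i) = fun i => (Dset i).indicator fun _ => (1 : ℝ) :=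
    funext digit_eq
  rw [this]
  apply ProbabilityTheory.iIndepSet.iIndepFun_indicator
  rw [ProbabilityTheory.iIndepSet_iff_meas_biInter measurableSet_Dset]
  intro s
  rw [meas_inter, Finset.prod_congr rfl fun i _ => meas_Dset i, Finset.prod_const]

lemma law_digit (i : ℕ) : (volume.restrict (Set.Ico (0 : ℝ) 1)).map (fun x => digitR x i) =
    (volume.restrict (Set.Ico (0 : ℝ) 1)).map (fun x => digitR x 0) := by
  ext B hB
  rw [Measure.map_apply (measurable_digit _) hB, Measure.map_apply (measurable_digit _) hB,
    digit_eq, digit_eq]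
  have hc : ∀ j, (volume.restrict (Set.Ico (0 : ℝ) 1)) (Dset j)ᶜ = 1 - 2⁻¹ := fun j => by
    rw [prob_compl_eq_one_sub (measurableSet_Dset j), meas_Dset]
  classical
  rw [Set.indicator_const_preimage_eq_union, Set.indicator_const_preimage_eq_union]
  by_cases h1 : (1 : ℝ) ∈ B <;> by_cases h0 : (0 : ℝ) ∈ B <;> simp only [h1, h0, if_true, if_false, Set.union_empty, Set.empty_union, Set.union_compl_self, meas_Dset, hc]

/-- Sigma-algebra generated by the digits in rows belonging to `S`. -/
@[reducible] noncomputable def rowAlg (S : Set ℕ) : MeasurableSpace ℝ :=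
  ⨆ i ∈ {i : ℕ | (Nat.unpair i).1 ∈ S}, MeasurableSpace.comap (fun x => digitR x i) inferInstance

lemma rowAlg_le (S : Set ℕ) : rowAlg S ≤ (inferInstance : MeasurableSpace ℝ) :=
  iSup₂_le fun i _ => (measurable_digit i).comap_le

lemma rowAlg_mono {S T : Set ℕ} (h : S ⊆ T) : rowAlg S ≤ rowAlg T :=
  biSup_mono fun _ hi => h hi

lemma rowAlg_indep {S T : Set ℕ} (h : Disjoint S T) :
    ProbabilityTheory.Indep (rowAlg S) (rowAlg T) (volume.restrict (Set.Ico (0 : ℝ) 1)) := by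
  refine ProbabilityTheory.indep_iSup_of_disjoint (fun i => (measurable_digit i).comap_le)
    iIndep_digit ?_
  rw [Set.disjoint_left] at h ⊢
  exact fun i hi hj => h hi hj

/-- The value of a digit row. -/
noncomputable def rowVal (d : ℕ → ℝ) : ℝ := ∑' j : ℕ, d j / 2 ^ (j + 1)

lemma measurable_rowVal : Measurable rowVal :=
  Measurable.tsum fun j => (measurable_pi_apply j).div_const _

lemma unif_eq (m : ℕ) : (fun x => unif x m) =
    rowVal ∘ (fun x j => digitR x (Nat.pair m j)) := rfl

lemma measurable_unif_row (m : ℕ) : Measurable[rowAlg {m}] fun x => unif x m := by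
  rw [unif_eq]
  refine measurable_rowVal.comp ?_
  refine @measurable_pi_lambda _ _ _ (_) _ _ fun j => ?_
  have : MeasurableSpace.comap (fun x => digitR x (Nat.pair m j)) inferInstance ≤ rowAlg {m} :=
    le_iSup₂_of_le (Nat.pair m j) (by simp) le_rfl
  exact Measurable.mono (comap_measurable _) this le_rfl

lemma law_unif (m : ℕ) : (volume.restrict (Set.Ico (0 : ℝ) 1)).map (fun x => unif x m) =
    (volume.restrict (Set.Ico (0 : ℝ) 1)).map (fun x => unif x 0) := by
  have h : ∀ m, (volume.restrict (Set.Ico (0 : ℝ) 1)).map (fun x => unif x m) =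
      (Measure.infinitePi fun _ : ℕ =>
        (volume.restrict (Set.Ico (0 : ℝ) 1)).map (fun x => digitR x 0)).map rowVal := by
    intro m
    rw [unif_eq, ← Measure.map_map measurable_rowVal
      (measurable_pi_lambda _ fun j => measurable_digit _)]
    congr 1
    have hi : Function.Injective (fun j => Nat.pair m j) := fun a b hab => by
      simpa using (Nat.pair_eq_pair.1 hab).2
    have := (iIndep_digit.precomp hi).map_fun_eq_infinitePi_map (fun j => measurable_digit _)
    rw [this]
    congr 1
    funext j
    exact law_digit _
  rw [h m, h 0]

end Digits

lemma measurable_sampleFin {n : ℕ} (hn : 0 < n) (p : Fin n → ℝ) :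
    Measurable (sampleFin hn p) := by
  classical
  let Φ : (Fin n → Prop) → Fin n := fun P =>
    if hs : (Finset.univ.filter fun y => P y).Nonempty
      then (Finset.univ.filter fun y => P y).min' hs else ⟨0, hn⟩
  have : sampleFin hn p = Φ ∘ fun u y => u < ∑ z ∈ Finset.univ.filter fun z : Fin n => z ≤ y, p z := by
    funext u
    simp only [sampleFin, Φ, Function.comp]
  rw [this]
  refine (measurable_of_finite Φ).comp ?_
  refine measurable_pi_lambda _ fun y => ?_
  exact measurableSet_setOfPred.1 measurableSet_Iio

lemma measurable_sampleOn {β : Type*} [Fintype β] [Nonempty β] [MeasurableSpace β]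
    (p : β → ℝ) : Measurable (sampleOn p) :=
  (measurable_of_finite (Fintype.equivFin β).symm).comp (measurable_sampleFin _ _)

section Chain

lemma decomp {E : Type*} [Fintype E] (P : (E → ℝ) →ₗ[ℝ] (E → ℝ)) (hP : ∀ v, ‖P v‖ ≤ ‖v‖)
    (r : E → ℝ) : ∃ h u : E → ℝ, P h = h ∧ r = h + (u - P u) := by
  let T : (E → ℝ) →ₗ[ℝ] (E → ℝ) := LinearMap.id - P
  have hT : ∀ v, T v = v - P v := fun v => rfl
  have hd : Disjoint (LinearMap.ker T) (LinearMap.range T) := by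
    rw [Submodule.disjoint_def]
    rintro v hv ⟨u, rfl⟩
    rw [LinearMap.mem_ker] at hv
    set v := T u with hvdef
    have hPv : P v = v := by have := hT v; rw [hv] at this; exact (sub_eq_zero.1 this.symm).symm
    have hPu : P u = u - v := by rw [hvdef, hT]; abel
    have hn : ∀ n : ℕ, ‖u - (n : ℝ) • v‖ ≤ ‖u‖ := by
      intro n
      induction n with
      | zero => simp
      | succ n ih =>
        have : u - ((n + 1 : ℕ) : ℝ) • v = P (u - (n : ℝ) • v) := by
          rw [map_sub, map_smul, hPv, hPu]; push_cast; rw [add_smul, one_smul]; abel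
        rw [this]
        exact (hP _).trans ih
    by_contra hne
    have hpos : 0 < ‖v‖ := norm_pos_iff.2 hne
    obtain ⟨n, hn'⟩ := exists_nat_gt (2 * ‖u‖ / ‖v‖)
    rw [div_lt_iff₀ hpos] at hn'
    have h1 : ‖(n : ℝ) • v‖ ≤ ‖u‖ + ‖u - (n : ℝ) • v‖ := by
      have := norm_sub_le u (u - (n : ℝ) • v)
      simpa using this
    rw [norm_smul, Real.norm_natCast] at h1
    linarith [hn n]
  have htop := Submodule.eq_top_of_disjoint (LinearMap.ker T) (LinearMap.range T)
    (by rw [add_comm]; exact (LinearMap.finrank_range_add_finrank_ker T).ge) hd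
  have : r ∈ LinearMap.ker T ⊔ LinearMap.range T := htop ▸ Submodule.mem_top
  obtain ⟨h, hh, w, ⟨u, rfl⟩, hr⟩ := Submodule.mem_sup.1 this
  refine ⟨h, u, ?_, ?_⟩
  · rw [LinearMap.mem_ker, hT] at hh
    exact (sub_eq_zero.1 hh).symm
  · rw [← hr, hT]

/-- Kronecker's lemma with weights `m + 1`. -/
lemma kronecker (D : ℕ → ℝ) (l : ℝ)
    (h : Tendsto (fun n => ∑ m ∈ Finset.range n, D m / (m + 1)) atTop (nhds l)) :
    Tendsto (fun n : ℕ => (n⁻¹ : ℝ) * ∑ m ∈ Finset.range n, D m) atTop (nhds 0) := by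
  set N : ℕ → ℝ := fun n => ∑ m ∈ Finset.range n, D m / (m + 1) with hN
  have key : ∀ n : ℕ, ∑ m ∈ Finset.range n, D m = n * N n - ∑ m ∈ Finset.range n, N m := by
    intro n
    induction n with
    | zero => simp
    | succ n ih =>
      rw [Finset.sum_range_succ, ih, Finset.sum_range_succ]
      have : N (n + 1) = N n + D n / (n + 1) := by simp only [hN]; rw [Finset.sum_range_succ]
      rw [this]
      have : (n : ℝ) + 1 ≠ 0 := by positivity
      push_cast
      field_simp
      ring
  have h2 := h.sub h.cesaro
  rw [sub_self] at h2
  refine h2.congr' ?_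
  filter_upwards [eventually_gt_atTop 0] with n hn
  rw [key]
  have : (n : ℝ) ≠ 0 := by positivity
  field_simp

variable {Ω : Type*} {m0 : MeasurableSpace Ω} {μ : Measure Ω} [IsProbabilityMeasure μ]

/-- Bounded martingale differences: normalized sums tend to zero. -/
lemma mart_diff (ℱ : Filtration ℕ m0) (D : ℕ → Ω → ℝ) (C : ℝ)
    (hD : ∀ n, StronglyMeasurable[ℱ (n + 1)] (D n)) (hC : ∀ n ω, |D n ω| ≤ C)
    (hc : ∀ n, μ[D n | ℱ n] =ᵐ[μ] 0) :
    ∀ᵐ ω ∂μ, Tendsto (fun n : ℕ => (n⁻¹ : ℝ) * ∑ m ∈ Finset.range n, D m ω) atTop (nhds 0) := by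
  have hDm : ∀ n, StronglyMeasurable (D n) := fun n => (hD n).mono (ℱ.le _)
  have hDi : ∀ n, Integrable (D n) μ := fun n =>
    Integrable.of_bound (hDm n).aestronglyMeasurable C (ae_of_all _ (hC n))
  let N : ℕ → Ω → ℝ := fun n ω => ∑ m ∈ Finset.range n, D m ω / (m + 1)
  have hNs : ∀ n, N (n + 1) = N n + ((n : ℝ) + 1)⁻¹ • D n := by
    intro n; funext ω
    simp only [N, Finset.sum_range_succ, Pi.add_apply, Pi.smul_apply, smul_eq_mul]
    ring
  have hNm : ∀ n, StronglyMeasurable[ℱ n] (N n) := by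
    intro n
    induction n with
    | zero => simp only [N, Finset.range_zero, Finset.sum_empty]; exact stronglyMeasurable_const
    | succ n ih =>
      rw [hNs]
      exact (ih.mono (ℱ.mono n.le_succ)).add ((hD n).const_smul _)
  have hC0 : 0 ≤ C := by
    obtain ⟨ω⟩ : Nonempty Ω := μ.nonempty_of_neZero
    exact (abs_nonneg _).trans (hC 0 ω)
  have hNb : ∀ n, ∃ B, ∀ ω, |N n ω| ≤ B := by
    intro n
    refine ⟨∑ m ∈ Finset.range n, C / (m + 1), fun ω => ?_⟩
    refine (Finset.abs_sum_le_sum_abs _ _).trans (Finset.sum_le_sum fun m _ => ?_)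
    rw [abs_div, abs_of_pos (show (0 : ℝ) < m + 1 by positivity)]
    gcongr
    exact hC m ω
  have hbi : ∀ f : Ω → ℝ, StronglyMeasurable f → (∃ B, ∀ ω, |f ω| ≤ B) → Integrable f μ :=
    fun f hf ⟨B, hB⟩ => Integrable.of_bound hf.aestronglyMeasurable B (ae_of_all _ hB)
  have hNi : ∀ n, Integrable (N n) μ := fun n => hbi _ ((hNm n).mono (ℱ.le _)) (hNb n)
  have hNDi : ∀ n, Integrable (N n * D n) μ := fun n => by
    refine hbi _ (((hNm n).mono (ℱ.le _)).mul (hDm n)) ?_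
    obtain ⟨B, hB⟩ := hNb n
    refine ⟨B * C, fun ω => ?_⟩
    rw [Pi.mul_apply, abs_mul]
    exact mul_le_mul (hB ω) (hC n ω) (abs_nonneg _) ((abs_nonneg _).trans (hB ω))
  have hmart : Martingale N ℱ μ := by
    refine martingale_nat hNm hNi fun n => ?_
    have e1 : μ[N (n + 1) | ℱ n] =ᵐ[μ] μ[N n | ℱ n] + μ[((n : ℝ) + 1)⁻¹ • D n | ℱ n] := by
      rw [hNs]
      exact condExp_add (hNi n) ((hDi n).smul _) _
    have e2 := condExp_smul (μ := μ) (((n : ℝ) + 1)⁻¹) (D n) (ℱ n)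
    rw [condExp_of_stronglyMeasurable (ℱ.le n) (hNm n) (hNi n)] at e1
    filter_upwards [e1, e2, hc n] with ω h1 h2 h3
    rw [h1, Pi.add_apply, h2, Pi.smul_apply, h3]
    simp
  have horth : ∀ n, ∫ ω, N n ω * D n ω ∂μ = 0 := by
    intro n
    have h1 := condExp_mul_of_stronglyMeasurable_left (hNm n) (hNDi n) (hDi n)
    have h2 : ∫ ω, (μ[N n * D n | ℱ n]) ω ∂μ = ∫ ω, (N n * D n) ω ∂μ := integral_condExp (ℱ.le n)
    have h3 : μ[N n * D n | ℱ n] =ᵐ[μ] 0 := by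
      filter_upwards [h1, hc n] with ω a b
      rw [a, Pi.mul_apply, b]; simp
    rw [integral_congr_ae h3] at h2
    simpa using h2.symm
  have hN2i : ∀ n, Integrable (fun ω => N n ω ^ 2) μ := fun n => by
    refine hbi _ (((hNm n).mono (ℱ.le _)).pow 2) ?_
    obtain ⟨B, hB⟩ := hNb n
    refine ⟨B ^ 2, fun ω => ?_⟩
    rw [abs_pow]
    exact pow_le_pow_left₀ (abs_nonneg _) (hB ω) 2
  have hD2i : ∀ n, Integrable (fun ω => D n ω ^ 2) μ := fun n => by
    refine hbi _ ((hDm n).pow 2) ⟨C ^ 2, fun ω => ?_⟩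
    rw [abs_pow]
    exact pow_le_pow_left₀ (abs_nonneg _) (hC n ω) 2
  have hN2 : ∀ n, ∫ ω, N n ω ^ 2 ∂μ ≤ ∑ m ∈ Finset.range n, C ^ 2 * (1 / ((m : ℝ) + 1) ^ 2) := by
    intro n
    induction n with
    | zero => simp [N]
    | succ n ih =>
      rw [Finset.sum_range_succ]
      have : ∀ ω, N (n + 1) ω ^ 2 = N n ω ^ 2 + (2 * ((n : ℝ) + 1)⁻¹) * (N n ω * D n ω)
          + (1 / ((n : ℝ) + 1) ^ 2) * D n ω ^ 2 := by
        intro ω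
        rw [hNs]
        simp only [Pi.add_apply, Pi.smul_apply, smul_eq_mul]
        field_simp
        ring
      simp_rw [this]
      have i1 : Integrable (fun ω => (2 * ((n : ℝ) + 1)⁻¹) * (N n ω * D n ω)) μ :=
        (hNDi n).const_mul _
      have i2 : Integrable (fun ω => N n ω ^ 2 + (2 * ((n : ℝ) + 1)⁻¹) * (N n ω * D n ω)) μ :=
        (hN2i n).add i1
      rw [integral_add i2 ((hD2i n).const_mul _), integral_add (hN2i n) i1, integral_const_mul, integral_const_mul,
        horth, mul_zero, add_zero, mul_comm (C ^ 2)]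
      refine add_le_add ih ?_
      gcongr
      calc ∫ ω, D n ω ^ 2 ∂μ ≤ ∫ _, C ^ 2 ∂μ := integral_mono (hD2i n) (integrable_const _)
            fun ω => by
              have := pow_le_pow_left₀ (abs_nonneg _) (hC n ω) 2
              simpa using this
        _ = C ^ 2 := by simp
  have hsum : Summable fun m : ℕ => C ^ 2 * (1 / ((m : ℝ) + 1) ^ 2) := by
    refine Summable.mul_left _ ?_
    have := (summable_nat_add_iff 1).2 (Real.summable_one_div_nat_pow.2 (one_lt_two))
    simpa using this
  set R : ℝ := ∑' m : ℕ, C ^ 2 * (1 / ((m : ℝ) + 1) ^ 2) with hR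
  have hbound : ∀ n, eLpNorm (N n) 1 μ ≤ ((1 + R).toNNReal : ENNReal) := by
    intro n
    rw [eLpNorm_one_eq_lintegral_enorm, ← ofReal_integral_norm_eq_lintegral_enorm (hNi n)]
    refine ENNReal.ofReal_le_ofReal ?_
    have h1 : ∫ ω, ‖N n ω‖ ∂μ ≤ ∫ ω, (1 + N n ω ^ 2) ∂μ := by
      refine integral_mono (hNi n).norm ((integrable_const _).add (hN2i n)) fun ω => ?_
      simp only [Real.norm_eq_abs]
      rw [← sq_abs]
      nlinarith [sq_nonneg (|N n ω| - 1), abs_nonneg (N n ω)]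
    rw [integral_add (integrable_const _) (hN2i n)] at h1
    have h2 := hsum.sum_le_tsum (Finset.range n) (fun m _ => by positivity)
    have h3 := hN2 n
    simp only [integral_const, probReal_univ, one_smul] at h1
    linarith
  filter_upwards [hmart.submartingale.exists_ae_tendsto_of_bdd hbound] with ω ⟨l, hl⟩
  exact kronecker _ l hl

theorem chain_avg (ℱ : Filtration ℕ m0) {E : Type*} [Fintype E] [MeasurableSpace E]
    [MeasurableSingletonClass E] (X : ℕ → Ω → E) (hX : ∀ n, Measurable[ℱ n] (X n))
    (U : ℕ → Ω → ℝ) (𝒢 : ℕ → MeasurableSpace Ω) (h𝒢 : ∀ n, 𝒢 n ≤ m0)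
    (hU : ∀ n, Measurable[𝒢 n] (U n)) (hind : ∀ n, ProbabilityTheory.Indep (𝒢 n) (ℱ n) μ)
    (hν : ∀ n, μ.map (U n) = μ.map (U 0)) (f : E → ℝ → E) (hf : ∀ x, Measurable (f x))
    (hstep : ∀ n ω, X (n + 1) ω = f (X n ω) (U n ω)) (r : E → ℝ) :
    ∀ᵐ ω ∂μ, ∃ l : ℝ,
      Tendsto (fun n : ℕ => (1 / n : ℝ) * ∑ m ∈ Finset.range n, r (X m ω)) atTop (nhds l) := by
  classical
  have hUm : ∀ n, Measurable (U n) := fun n => (hU n).mono (h𝒢 n) le_rfl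
  set ν := μ.map (U 0) with hνdef
  have : IsProbabilityMeasure ν := Measure.isProbabilityMeasure_map (hUm 0).aemeasurable
  have hvm : ∀ v : E → ℝ, Measurable v := fun v => measurable_of_finite v
  have hvb : ∀ (v : E → ℝ) x, ‖v x‖ ≤ ‖v‖ := fun v x => norm_le_pi_norm v x
  have hint : ∀ (v : E → ℝ) x, Integrable (fun u => v (f x u)) ν := fun v x =>
    Integrable.of_bound ((hvm v).comp (hf x)).aestronglyMeasurable ‖v‖
      (ae_of_all _ fun u => hvb v _)
  let P : (E → ℝ) →ₗ[ℝ] (E → ℝ) :=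
    { toFun := fun v x => ∫ u, v (f x u) ∂ν
      map_add' := fun v w => by
        funext x
        exact integral_add (hint v x) (hint w x)
      map_smul' := fun c v => by
        funext x
        exact integral_const_mul c _ }
  have hPdef : ∀ v x, P v x = ∫ u, v (f x u) ∂ν := fun v x => rfl
  have hP : ∀ v, ‖P v‖ ≤ ‖v‖ := by
    intro v
    rw [pi_norm_le_iff_of_nonneg (norm_nonneg _)]
    intro x
    rw [hPdef]
    have := norm_integral_le_of_norm_le_const (μ := ν) (f := fun u => v (f x u)) (C := ‖v‖)
      (ae_of_all _ fun u => hvb v _)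
    simpa using this
  have hXs : ∀ (v : E → ℝ) n, StronglyMeasurable[ℱ n] (fun ω => v (X n ω)) := fun v n =>
    Measurable.stronglyMeasurable ((hvm v).comp (hX n))
  have hXi : ∀ (v : E → ℝ) n, Integrable (fun ω => v (X n ω)) μ := fun v n =>
    Integrable.of_bound ((hXs v n).mono (ℱ.le n)).aestronglyMeasurable ‖v‖
      (ae_of_all _ fun ω => hvb v _)
  have hcond : ∀ (v : E → ℝ) n, μ[fun ω => v (X (n + 1) ω) | ℱ n] =ᵐ[μ]
      fun ω => P v (X n ω) := by
    intro v n
    let I : E → Ω → ℝ := fun x ω => if X n ω = x then 1 else 0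
    let G : E → Ω → ℝ := fun x ω => v (f x (U n ω))
    have hIs : ∀ x, StronglyMeasurable[ℱ n] (I x) := fun x =>
      hXs (fun y => if y = x then 1 else 0) n
    have hGs : ∀ x, StronglyMeasurable[𝒢 n] (G x) := fun x =>
      Measurable.stronglyMeasurable (((hvm v).comp (hf x)).comp (hU n))
    have hGi : ∀ x, Integrable (G x) μ := fun x =>
      Integrable.of_bound ((hGs x).mono (h𝒢 n)).aestronglyMeasurable ‖v‖
        (ae_of_all _ fun ω => hvb v _)
    have hIGi : ∀ x, Integrable (I x * G x) μ := fun x => by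
      refine Integrable.of_bound
        (((hIs x).mono (ℱ.le n)).mul ((hGs x).mono (h𝒢 n))).aestronglyMeasurable ‖v‖
        (ae_of_all _ fun ω => ?_)
      simp only [Pi.mul_apply, I, G]
      split_ifs
      · simpa using hvb v _
      · simp
    have e1 : (fun ω => v (X (n + 1) ω)) = ∑ x : E, I x * G x := by
      funext ω
      simp [I, G, Finset.sum_apply, hstep]
    have e2 := condExp_finsetSum (μ := μ) (s := Finset.univ) (f := fun x => I x * G x)
      (fun x _ => hIGi x) (ℱ n)
    rw [← e1] at e2
    have e3 : ∀ᵐ ω ∂μ, ∀ x, (μ[I x * G x | ℱ n]) ω = I x ω * P v x := by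
      rw [ae_all_iff]
      intro x
      have a := condExp_mul_of_stronglyMeasurable_left (hIs x) (hIGi x) (hGi x)
      have b := MeasureTheory.condExp_indep_eq (h𝒢 n) (ℱ.le n) (hGs x) (hind n)
      have c : ∫ ω, G x ω ∂μ = P v x := by
        rw [hPdef, ← hν n, integral_map (hUm n).aemeasurable]
        exact ((hvm v).comp (hf x)).aestronglyMeasurable
      filter_upwards [a, b] with ω ha hb
      rw [ha, Pi.mul_apply, hb, c]
    filter_upwards [e2, e3] with ω h2 h3
    rw [h2, Finset.sum_apply]
    simp only [h3, I]
    simp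
  obtain ⟨h, u, hh, hr⟩ := decomp P hP r
  have hconv : ∀ᵐ ω ∂μ, ∃ l, Tendsto (fun n => h (X n ω)) atTop (nhds l) := by
    have hm : Martingale (fun n ω => h (X n ω)) ℱ μ := by
      refine martingale_nat (hXs h) (hXi h) fun n => ?_
      have := hcond h n
      rw [hh] at this
      exact this.symm
    refine hm.submartingale.exists_ae_tendsto_of_bdd (R := ‖h‖₊) fun n => ?_
    have := eLpNorm_le_of_ae_bound (p := 1) (μ := μ) (f := fun ω => h (X n ω)) (C := ‖h‖)
      (ae_of_all _ fun ω => hvb h _)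
    simpa [← enorm_eq_nnnorm] using this
  have hdiff := mart_diff (μ := μ) ℱ (fun n ω => u (X (n + 1) ω) - P u (X n ω)) (2 * ‖u‖)
    (fun n => (hXs u (n + 1)).sub ((hXs (P u) n).mono (ℱ.mono n.le_succ)))
    (fun n ω => by
      have h1 := hvb u (X (n + 1) ω)
      have h2 := (hvb (P u) (X n ω)).trans (hP u)
      have h3 := norm_sub_le (u (X (n + 1) ω)) (P u (X n ω))
      rw [← Real.norm_eq_abs]
      linarith)
    (fun n => by
      have a := condExp_sub (μ := μ) (hXi u (n + 1)) (hXi (P u) n) (ℱ n)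
      rw [condExp_of_stronglyMeasurable (ℱ.le n) (hXs (P u) n) (hXi (P u) n)] at a
      have b := hcond u n
      filter_upwards [a, b] with ω ha hb
      have : (fun ω => u (X (n + 1) ω) - P u (X n ω)) =
        (fun ω => u (X (n + 1) ω)) - fun ω => P u (X n ω) := rfl
      rw [this, ha, Pi.sub_apply, hb]
      simp)
  filter_upwards [hconv, hdiff] with ω ⟨l, hl⟩ hd
  refine ⟨l, ?_⟩
  have hz : Tendsto (fun n : ℕ => (n⁻¹ : ℝ) * (u (X 0 ω) - u (X n ω))) atTop (nhds 0) := by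
    refine squeeze_zero_norm (a := fun n : ℕ => (n⁻¹ : ℝ) * (2 * ‖u‖)) (fun n => ?_) ?_
    · rw [norm_mul, norm_inv, Real.norm_natCast]
      gcongr
      have h3 := norm_sub_le (u (X 0 ω)) (u (X n ω))
      linarith [hvb u (X 0 ω), hvb u (X n ω)]
    · simpa using (tendsto_inv_atTop_nhds_zero_nat (𝕜 := ℝ)).mul_const (2 * ‖u‖)
  have := (hl.cesaro.add hd).add hz
  simp only [add_zero] at this
  refine this.congr fun n => ?_
  rw [one_div, ← mul_add, ← mul_add]
  congr 1
  induction n with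
  | zero => simp
  | succ n ih =>
    rw [Finset.sum_range_succ, Finset.sum_range_succ, Finset.sum_range_succ, ← ih]
    have : r (X n ω) = h (X n ω) + (u (X n ω) - P u (X n ω)) := congrFun hr _
    rw [this]
    ring

end Chain

/-- For every POMDP, initial belief and finite-memory strategy, the average rewards
converge almost surely. -/
theorem finiteMemory_avg_converges (Γ : POMDP) (p1 : Γ.K → ℝ) (hp1 : IsBelief p1)
    (σ : Γ.Strategy) (hσ : Γ.FiniteMemory σ) :
    ∀ᵐ ω ∂(Γ.envMeasure p1), ∃ L : ℝ, Tendsto (Γ.avg σ ω) atTop (nhds L) := by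
  obtain ⟨nM, m₀, σa, σu, hσ⟩ := hσ
  have main : ∀ k : Γ.K, ∀ᵐ x ∂(volume.restrict (Set.Ico (0 : ℝ) 1)),
      ∃ L : ℝ, Tendsto (Γ.avg σ (k, x)) atTop (nhds L) := by
    intro k
    let f : Γ.K × Fin nM → ℝ → Γ.K × Fin nM := fun e u =>
      ((sampleOn (Γ.q e.1 (σa e.2)) u).1,
        σu e.2 (σa e.2, (sampleOn (Γ.q e.1 (σa e.2)) u).2))
    have hf : ∀ e, Measurable (f e) := fun e =>
      (measurable_of_finite fun y : Γ.K × Γ.S => (y.1, σu e.2 (σa e.2, y.2))).comp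
        (measurable_sampleOn (Γ.q e.1 (σa e.2)))
    let X : ℕ → ℝ → Γ.K × Fin nM := fun n x =>
      (Γ.state σ (k, x) n, (Γ.hist σ (k, x) n).foldl σu m₀)
    have hstep : ∀ n x, X (n + 1) x = f (X n x) (unif x n) := by
      intro n x
      simp only [X, f, POMDP.state, POMDP.hist, POMDP.traj, hσ, List.foldl_append, List.foldl_cons,
        List.foldl_nil]
    let ℱ : Filtration ℕ (inferInstance : MeasurableSpace ℝ) :=
      { seq := fun n => rowAlg (Set.Iio n)
        mono' := fun a b hab => rowAlg_mono (Set.Iio_subset_Iio hab)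
        le' := fun n => rowAlg_le _ }
    have hX : ∀ n, Measurable[ℱ n] (X n) := by
      intro n
      induction n with
      | zero =>
        have h0 : X 0 = fun _ => (k, m₀) := rfl
        rw [h0]
        exact measurable_const
      | succ n ih =>
        have h1 : Measurable[ℱ (n + 1)] (X n) := ih.mono (ℱ.mono n.le_succ) le_rfl
        have h2 : Measurable[ℱ (n + 1)] (fun x => unif x n) :=
          (measurable_unif_row n).mono (rowAlg_mono (by simp)) le_rfl
        have h3 : Measurable (fun p : (Γ.K × Fin nM) × ℝ => f p.1 p.2) :=
          measurable_from_prod_countable_right hf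
        have h4 : X (n + 1) = (fun p : (Γ.K × Fin nM) × ℝ => f p.1 p.2) ∘
            fun x => (X n x, unif x n) := funext fun x => hstep n x
        rw [h4]
        exact h3.comp (h1.prodMk h2)
    have := chain_avg (μ := volume.restrict (Set.Ico (0 : ℝ) 1)) ℱ X hX (fun n x => unif x n)
      (fun n => rowAlg {n}) (fun n => rowAlg_le _) measurable_unif_row
      (fun n => rowAlg_indep (by simp)) law_unif f hf hstep (fun e => Γ.g e.1 (σa e.2))
    filter_upwards [this] with x ⟨L, hL⟩
    refine ⟨L, hL.congr fun n => ?_⟩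
    simp only [POMDP.avg, POMDP.rew, POMDP.act, X, hσ]
  have h2 : ∀ᵐ ω ∂(Γ.envMeasure p1), ∀ k : Γ.K,
      ∃ L : ℝ, Tendsto (Γ.avg σ (k, ω.2)) atTop (nhds L) := by
    rw [ae_all_iff]
    intro k
    exact Measure.quasiMeasurePreserving_snd.ae (main k)
  filter_upwards [h2] with ω h
  exact h ω.1

end PomdpPaper
end

section
/- For the POMDP Γ_ex with initial state k₀ (initial belief δ_{k₀}), the value is v_∞(δ_{k₀}) = 5/6. -/
open MeasureTheory Filter

namespace PomdpPaper

/-- The transition function of the example POMDP `Γex` (states `k₀,…,k₄ = 0,…,4`, actions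
`a = 0`, `b = 1`, signals `s_a = 0`, `s_b = 1`). -/
noncomputable def qex : Fin 5 → Fin 2 → Fin 5 × Fin 2 → ℝ := fun k act y =>
  if k = 0 then (if y = (1, 1) then 1 / 2 else if y = (3, 0) then 1 / 2 else 0)
  else if k = 1 then
    (if act = 0 then (if y = (1, 0) then 1 / 2 else if y = (2, 1) then 1 / 2 else 0)
     else (if y = (4, 0) then 1 else 0))
  else if k = 2 then
    (if act = 0 then (if y = (4, 0) then 1 else 0)
     else (if y = (1, 0) then 1 else 0))
  else if k = 3 then
    (if act = 0 then (if y = (3, 0) then 1 / 2 else if y = (3, 1) then 1 / 2 else 0)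
     else (if y = (4, 0) then 1 else 0))
  else (if y = (4, 0) then 1 else 0)

/-- The reward function of `Γex`: reward `1` in states `k₁` and `k₃`, and `0` otherwise. -/
noncomputable def gex : Fin 5 → Fin 2 → ℝ := fun k _ =>
  if k = 1 ∨ k = 3 then 1 else 0

/-- The example POMDP of Remark 5 of the paper. -/
noncomputable def Γex : POMDP where
  nK := 5
  nA := 2
  nS := 2
  hK := by norm_num
  hA := by norm_num
  hS := by norm_num
  q := qex
  q_nonneg := by
    intro k a y
    simp only [qex]
    split_ifs <;> norm_num
  q_sum := by
    intro k a
    fin_cases k <;> fin_cases a <;>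
      simp [qex, Fintype.sum_prod_type, Fin.sum_univ_five, Fin.sum_univ_two,
        Prod.ext_iff] <;>
      norm_num <;> decide
  g := gex
  g_nonneg := by
    intro k a
    simp only [gex]
    split_ifs <;> norm_num
  g_le_one := by
    intro k a
    simp only [gex]
    split_ifs <;> norm_num

open ProbabilityTheory

def Dep (i : ℕ) (P : ℝ → Prop) : Prop :=
  ∀ x y : ℝ, ⌊x * 2 ^ i⌋ = ⌊y * 2 ^ i⌋ → (P x ↔ P y)

noncomputable abbrev mu : Measure ℝ := volume.restrict (Set.Ico (0 : ℝ) 1)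

instance : IsProbabilityMeasure mu := ⟨by simp [mu]⟩

lemma floor_mono_pow (x : ℝ) {i j : ℕ} (h : i ≤ j) :
    ⌊x * 2 ^ i⌋ = ⌊x * 2 ^ j⌋ / (2 ^ (j - i) : ℕ) := by
  rw [← Int.floor_div_natCast]
  congr 1
  obtain ⟨k, rfl⟩ := Nat.exists_eq_add_of_le h
  simp [pow_add]
  field_simp

lemma Dep.mono {i j : ℕ} {P : ℝ → Prop} (hP : Dep i P) (h : i ≤ j) : Dep j P := by
  intro x y hxy
  apply hP
  rw [floor_mono_pow x h, floor_mono_pow y h, hxy]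

lemma digit_eq_of_floor {x y : ℝ} {i l : ℕ} (h : l < i) (hxy : ⌊x * 2 ^ i⌋ = ⌊y * 2 ^ i⌋) :
    digitR x l = digitR y l := by
  unfold digitR
  rw [floor_mono_pow x (show l + 1 ≤ i from h), floor_mono_pow y (show l + 1 ≤ i from h), hxy]

lemma Dep.meas {i : ℕ} {P : ℝ → Prop} (hP : Dep i P) : MeasurableSet {x | P x} := by
  have : {x | P x} = (fun x : ℝ => ⌊x * 2 ^ i⌋) ⁻¹' ((fun x : ℝ => ⌊x * 2 ^ i⌋) '' {x | P x}) := by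
    ext x
    simp only [Set.mem_ofPred_eq, Set.mem_preimage, Set.mem_image]
    constructor
    · intro h; exact ⟨x, h, rfl⟩
    · rintro ⟨y, hy, e⟩; exact (hP y x e).1 hy
  rw [this]
  have hm : Measurable (fun x : ℝ => ⌊x * 2 ^ i⌋) := by fun_prop
  exact hm (MeasurableSet.of_discrete)

lemma Dep.digit (i : ℕ) : Dep (i+1) (fun x => digitR x i = 1) := by
  intro x y h
  simp only [digit_eq_of_floor (Nat.lt_succ_self i) h]

lemma Dep.and {i : ℕ} {P Q : ℝ → Prop} (hP : Dep i P) (hQ : Dep i Q) :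
    Dep i (fun x => P x ∧ Q x) := fun x y h => and_congr (hP x y h) (hQ x y h)
lemma Dep.not {i : ℕ} {P : ℝ → Prop} (hP : Dep i P) :
    Dep i (fun x => ¬ P x) := fun x y h => not_congr (hP x y h)
lemma Dep.iff {i : ℕ} {P Q : ℝ → Prop} (hP : Dep i P) (hQ : Dep i Q) :
    Dep i (fun x => (P x ↔ Q x)) := fun x y h => iff_congr (hP x y h) (hQ x y h)

lemma mu_half {i : ℕ} {P : ℝ → Prop} (hP : Dep i P) :
    mu {x | P x ∧ digitR x i = 1} = mu {x | P x ∧ ¬ digitR x i = 1} := by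
  have h1 : MeasurableSet {x | P x ∧ digitR x i = 1} :=
    ((hP.mono (Nat.le_succ i)).and (Dep.digit i)).meas
  have h2 : MeasurableSet {x | P x ∧ ¬ digitR x i = 1} :=
    ((hP.mono (Nat.le_succ i)).and (Dep.digit i).not).meas
  rw [Measure.restrict_apply h1, Measure.restrict_apply h2]
  rw [← measure_preimage_add_right volume ((2:ℝ) ^ (i+1))⁻¹]
  congr 1
  ext x
  have hf : ⌊(x + ((2:ℝ) ^ (i+1))⁻¹) * 2 ^ (i+1)⌋ = ⌊x * 2 ^ (i+1)⌋ + 1 := by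
    rw [add_mul, inv_mul_cancel₀ (by positivity), Int.floor_add_one]
  have hd : digitR (x + ((2:ℝ) ^ (i+1))⁻¹) i = 1 ↔ ¬ digitR x i = 1 := by
    unfold digitR
    rw [hf]
    split_ifs <;> simp <;> omega
  have hI : ∀ y : ℝ, y ∈ Set.Ico (0:ℝ) 1 ↔ 0 ≤ ⌊y * 2 ^ (i+1)⌋ ∧ ⌊y * 2 ^ (i+1)⌋ < 2 ^ (i+1) := by
    intro y
    rw [Int.floor_nonneg, Int.floor_lt]
    have : (0:ℝ) < 2 ^ (i+1) := by positivity
    push_cast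
    rw [Set.mem_Ico]
    constructor
    · rintro ⟨h1, h2⟩
      constructor
      · positivity
      · nlinarith
    · rintro ⟨h1, h2⟩
      constructor
      · by_contra h; nlinarith
      · by_contra h; nlinarith
  have h3 : digitR x i ≠ 1 → ((P (x + ((2:ℝ) ^ (i+1))⁻¹) ↔ P x) ∧
      (x + ((2:ℝ) ^ (i+1))⁻¹ ∈ Set.Ico (0:ℝ) 1 ↔ x ∈ Set.Ico (0:ℝ) 1)) := by
    intro h
    have he : ⌊x * 2 ^ (i+1)⌋ % 2 = 0 := by
      unfold digitR at h
      split_ifs at h <;> simp at h; omega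
    constructor
    · apply hP
      rw [floor_mono_pow _ (Nat.le_succ i), floor_mono_pow x (Nat.le_succ i)]
      simp only [Nat.succ_eq_add_one, hf, Nat.add_sub_cancel_left]
      push_cast
      omega
    · rw [hI, hI, hf]
      have : (2:ℤ)^(i+1) = 2 * 2^i := by ring
      rw [this]
      generalize (2:ℤ)^i = z
      omega
  simp only [Set.mem_preimage, Set.mem_inter_iff, Set.mem_ofPred_eq, hd]
  tauto

lemma mu_half' {i : ℕ} {P s : ℝ → Prop} (hP : Dep i P) (hs : Dep i s) :
    mu {x | P x ∧ (s x ↔ digitR x i = 1)} = mu {x | P x} / 2 := by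
  have dg := Dep.digit i
  have l := Nat.le_succ i
  have key : ∀ Q : ℝ → Prop, Dep i Q → mu {x | P x ∧ (Q x ↔ digitR x i = 1)} =
      mu {x | (P x ∧ Q x) ∧ digitR x i = 1} + mu {x | (P x ∧ ¬ Q x) ∧ ¬ digitR x i = 1} := by
    intro Q hQ
    rw [← measure_union]
    · congr 1; ext x; simp only [Set.mem_ofPred_eq, Set.mem_union]; tauto
    · rw [Set.disjoint_left]; intro x; simp only [Set.mem_ofPred_eq]; tauto
    · exact (((hP.and hQ.not).mono l).and dg.not).meas
  have h1 := key s hs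
  have h2 := key _ hs.not
  simp only [not_not] at h2
  rw [mu_half (hP.and hs), ← mu_half (hP.and hs.not), add_comm, ← h2] at h1
  have h3 : mu {x | P x} = mu {x | P x ∧ (s x ↔ digitR x i = 1)}
      + mu {x | P x ∧ (¬ s x ↔ digitR x i = 1)} := by
    rw [← measure_union]
    · congr 1; ext x; simp only [Set.mem_ofPred_eq, Set.mem_union]; tauto
    · rw [Set.disjoint_left]; intro x; simp only [Set.mem_ofPred_eq]; tauto
    · exact ((hP.mono l).and ((hs.not.mono l).iff dg)).meas
  rw [h3, ← h1, ← two_mul, mul_comm, ENNReal.mul_div_cancel_right (by simp) (by simp)]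

open Classical in
lemma slln {i : ℕ → ℕ} (hi : StrictMono i) {s : ℕ → ℝ → Prop} (hs : ∀ m, Dep (i m) (s m)) :
    ∀ᵐ x ∂mu, Tendsto (fun n : ℕ => (∑ m ∈ Finset.range n,
      (if (s m x ↔ digitR x (i m) = 1) then (1/2 : ℝ) else -(1/2))) / n) atTop (nhds 0) := by
  let A : ℕ → Set ℝ := fun m => {x | s m x ↔ digitR x (i m) = 1}
  have dA : ∀ m, Dep (i m + 1) (fun x => x ∈ A m) := fun m =>
    ((hs m).mono (Nat.le_succ _)).iff (Dep.digit _)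
  have mA : ∀ m, MeasurableSet (A m) := fun m => (dA m).meas
  let X : ℕ → ℝ → ℝ := fun m x => if (s m x ↔ digitR x (i m) = 1) then (1/2 : ℝ) else -(1/2)
  let B : ℕ → ℝ → Bool := fun m x => decide (x ∈ A m)
  have mB : ∀ m, Measurable (B m) := fun m => by
    apply measurable_to_bool
    convert mA m using 1
    ext x; simp [B]
  have half : ∀ m (P : ℝ → Prop), Dep (i m) P → ∀ b : Bool,
      mu {x | P x ∧ B m x = b} = mu {x | P x} / 2 := by
    intro m P hP b
    cases b
    · rw [← mu_half' hP (hs m).not]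
      congr 1; ext x; simp only [B, A, Set.mem_ofPred_eq, decide_eq_false_iff_not]; tauto
    · rw [← mu_half' hP (hs m)]
      congr 1; ext x; simp only [B, A, Set.mem_ofPred_eq, decide_eq_true_iff]
  have one : ∀ m (b : Bool), mu (B m ⁻¹' {b}) = 1/2 := by
    intro m b
    have := half m (fun _ => True) (fun _ _ _ => Iff.rfl) b
    simpa [Set.preimage] using this
  have ident : ∀ m, IdentDistrib (B m) (B 0) mu mu := by
    intro m
    refine ⟨(mB m).aemeasurable, (mB 0).aemeasurable, ?_⟩
    apply Measure.ext_of_singleton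
    intro b
    rw [Measure.map_apply (mB m) (MeasurableSet.of_discrete),
      Measure.map_apply (mB 0) (MeasurableSet.of_discrete), one, one]
  have ind' : ∀ m n, m < n → IndepFun (B m) (B n) mu := by
    intro m n hmn
    rw [indepFun_iff_map_prod_eq_prod_map_map (mB m).aemeasurable (mB n).aemeasurable]
    apply Measure.ext_of_singleton
    rintro ⟨b, c⟩
    rw [Measure.map_apply ((mB m).prodMk (mB n)) (MeasurableSet.of_discrete),
      ← Set.singleton_prod_singleton, Measure.prod_prod,
      Measure.map_apply (mB m) (MeasurableSet.of_discrete),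
      Measure.map_apply (mB n) (MeasurableSet.of_discrete), one n]
    have h := half n (fun x => B m x = b) (by
      have : Dep (i m + 1) (fun x => B m x = b) := by
        intro x y h
        have := dA m x y h
        simp only [B, this]
      exact this.mono (hi hmn)) c
    rw [mul_one_div]
    convert h using 2
    all_goals rfl
  have hX : ∀ m, X m = (fun b : Bool => if b then (1/2 : ℝ) else -(1/2)) ∘ B m := by
    intro m; ext x; simp [X, B, A]
  have sl := strong_law_ae_real (μ := mu) X ?_ ?_ ?_
  · have e : ∫ x, X 0 x ∂mu = 0 := by
      rw [hX]
      have : ∫ b : Bool, (if b then (1/2 : ℝ) else -(1/2)) ∂(mu.map (B 0)) = 0 := by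
        rw [integral_fintype (Integrable.of_finite)]
        simp [Measure.real, Measure.map_apply (mB 0), one]
      rw [integral_map (mB 0).aemeasurable (by fun_prop)] at this
      exact this
    rw [e] at sl
    exact sl
  · rw [hX]
    exact (Integrable.of_finite (μ := mu.map (B 0))).comp_measurable (mB 0)
  · intro m n hmn
    simp only [Function.onFun]
    rw [hX, hX]
    refine IndepFun.comp ?_ (by fun_prop) (by fun_prop)
    rcases lt_or_gt_of_ne hmn with h | h
    · exact ind' _ _ h
    · exact (ind' _ _ h).symm
  · intro m
    rw [hX, hX]
    exact (ident m).comp (by fun_prop)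
lemma sampleFin_spec {n : ℕ} (hn : 0 < n) (p : Fin n → ℝ) (h1 : ∑ z, p z = 1)
    (u : ℝ) (hu0 : 0 ≤ u) (hu1 : u < 1) :
    (∑ z ∈ Finset.univ.filter fun z : Fin n => z < sampleFin hn p u, p z) ≤ u ∧
    u < (∑ z ∈ Finset.univ.filter fun z : Fin n => z < sampleFin hn p u, p z)
      + p (sampleFin hn p u) := by
  classical
  set y := sampleFin hn p u with hy
  let s : Finset (Fin n) :=
    Finset.univ.filter fun y : Fin n => u < ∑ z ∈ Finset.univ.filter fun z : Fin n => z ≤ y, p z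
  have hs : s.Nonempty := by
    refine ⟨⟨n - 1, by omega⟩, ?_⟩
    simp only [s, Finset.mem_filter, Finset.mem_univ, true_and]
    have : (Finset.univ.filter fun z : Fin n => z ≤ ⟨n - 1, by omega⟩) = Finset.univ := by
      ext z; simp [Fin.le_def]; omega
    rw [this, h1]; exact hu1
  have hy' : y = s.min' hs := by
    rw [hy]; unfold sampleFin
    simp only [s]
    rw [dif_pos]
  have hmem : y ∈ s := hy' ▸ s.min'_mem hs
  have hmin : ∀ z ∈ s, y ≤ z := fun z hz => hy' ▸ s.min'_le z hz
  have hle : (Finset.univ.filter fun z : Fin n => z ≤ y)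
      = insert y (Finset.univ.filter fun z : Fin n => z < y) := by
    ext z; simp [le_iff_eq_or_lt]
  constructor
  · by_contra hc
    push Not at hc
    have hy0 : 0 < y.1 := by
      by_contra h0
      have : (Finset.univ.filter fun z : Fin n => z < y) = ∅ := by
        apply Finset.filter_eq_empty_iff.2
        intro z _ hz
        rw [Fin.lt_def] at hz
        omega
      rw [this] at hc; simp at hc; linarith
    have : (⟨y.1 - 1, by omega⟩ : Fin n) ∈ s := by
      simp only [s, Finset.mem_filter, Finset.mem_univ, true_and]
      have e : (Finset.univ.filter fun z : Fin n => z ≤ ⟨y.1 - 1, by omega⟩)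
          = Finset.univ.filter fun z : Fin n => z < y := by
        ext z; simp only [Finset.mem_filter, Finset.mem_univ, true_and, Fin.le_def, Fin.lt_def]; omega
      rw [e]; exact hc
    have := hmin _ this
    simp [Fin.le_def] at this; omega
  · simp only [s, Finset.mem_filter, Finset.mem_univ, true_and] at hmem
    rw [hle, Finset.sum_insert (by simp)] at hmem
    linarith

lemma sampleOn_spec {β : Type*} [Fintype β] [Nonempty β] (p : β → ℝ) (h1 : ∑ z, p z = 1) :
    ∃ L : β → ℝ, ∀ u : ℝ, 0 ≤ u → u < 1 →
      L (sampleOn p u) ≤ u ∧ u < L (sampleOn p u) + p (sampleOn p u) := by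
  refine ⟨fun y => ∑ z ∈ Finset.univ.filter
    fun z : Fin (Fintype.card β) => z < Fintype.equivFin β y, p ((Fintype.equivFin β).symm z), ?_⟩
  intro u h0 hu
  have := sampleFin_spec (Fintype.card_pos (α := β)) (fun i => p ((Fintype.equivFin β).symm i))
    (by rw [← h1]; exact (Fintype.equivFin β).symm.sum_comp p) u h0 hu
  unfold sampleOn
  simpa using this

lemma sampleOn_canon {β : Type*} [Fintype β] [Nonempty β] (p : β → ℝ)
    (hp : ∀ y, ∃ k : ℕ, p y = k / 2) (u : ℝ) (h0 : 0 ≤ u) (hu : u < 1) :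
    sampleOn p u = sampleOn p (if u < 1/2 then 0 else 1/2) := by
  choose k hk using hp
  have key : ∀ N : ℕ, u < (N:ℝ)/2 ↔ (if u < 1/2 then (0:ℝ) else 1/2) < (N:ℝ)/2 := by
    intro N
    rcases N with _ | _ | N
    · split_ifs <;> constructor <;> intro h <;> norm_num at * <;> linarith
    · split_ifs <;> constructor <;> intro h <;> norm_num at * <;> linarith
    · have : (1:ℝ) ≤ ((N + 1 + 1 : ℕ) : ℝ) / 2 := by push_cast; linarith [(Nat.cast_nonneg N : (0:ℝ) ≤ N)]
      split_ifs <;> constructor <;> intros <;> linarith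
  unfold sampleOn sampleFin
  simp only [hk, ← Finset.sum_div, ← Nat.cast_sum, key]

lemma summ_digit (x : ℝ) (i : ℕ → ℕ) : Summable (fun j => digitR x (i j) / 2 ^ (j + 1)) := by
  have h : Summable (fun j : ℕ => (1/2 : ℝ) ^ (j+1)) :=
    (summable_nat_add_iff 1).2 summable_geometric_two
  refine Summable.of_nonneg_of_le ?_ ?_ h
  · intro j; unfold digitR; split_ifs <;> positivity
  · intro j; unfold digitR; split_ifs <;> simp

def Good (x : ℝ) : Prop := ∀ m, ∃ j, digitR x (Nat.pair m (j+1)) ≠ 1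

lemma digit_le (x : ℝ) (i : ℕ) : digitR x i ≤ 1 := by unfold digitR; split_ifs <;> simp
lemma digit_nonneg (x : ℝ) (i : ℕ) : 0 ≤ digitR x i := by unfold digitR; split_ifs <;> simp
lemma digit_zero {x : ℝ} {i : ℕ} (h : digitR x i ≠ 1) : digitR x i = 0 := by
  unfold digitR at *; split_ifs at * <;> simp_all

lemma unif_good {x : ℝ} (hx : Good x) (m : ℕ) :
    0 ≤ unif x m ∧ unif x m < 1 ∧ (unif x m < 1/2 ↔ digitR x (Nat.pair m 0) ≠ 1) := by
  have hs := summ_digit x (fun j => Nat.pair m j)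
  have e : unif x m = digitR x (Nat.pair m 0) / 2
      + ∑' j, digitR x (Nat.pair m (j+1)) / 2 ^ (j + 1 + 1) := by
    unfold unif; rw [hs.tsum_eq_zero_add]; simp
  have g : ∑' j : ℕ, (1:ℝ) / 2 ^ (j+1+1) = 1/2 := by
    rw [← tsum_geometric_two' (1/2)]
    congr 1; ext j; rw [pow_succ, pow_succ]; field_simp
  have gs : Summable (fun j : ℕ => (1:ℝ) / 2 ^ (j+1+1)) := by
    have := (summable_nat_add_iff 2).2 summable_geometric_two
    refine this.congr fun j => ?_
    simp
  have lt : ∑' j, digitR x (Nat.pair m (j+1)) / 2 ^ (j + 1 + 1) < 1/2 := by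
    rw [← g]
    obtain ⟨j, hj⟩ := hx m
    refine Summable.tsum_lt_tsum (i := j) ?_ ?_ ((summable_nat_add_iff 1).2 hs) gs
    · intro j; 
      have := digit_le x (Nat.pair m (j+1))
      dsimp only
      gcongr
    · rw [digit_zero hj]; simp
  have ge : 0 ≤ ∑' j, digitR x (Nat.pair m (j+1)) / 2 ^ (j + 1 + 1) :=
    tsum_nonneg fun j => div_nonneg (digit_nonneg _ _) (by positivity)
  rw [e]
  by_cases h : digitR x (Nat.pair m 0) = 1
  · rw [h]
    refine ⟨by linarith, by linarith, ?_⟩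
    simp; linarith
  · rw [digit_zero h]
    refine ⟨by linarith, by linarith, ?_⟩
    simp; linarith

lemma ae_good : ∀ᵐ x ∂mu, Good x := by
  unfold Good
  rw [ae_all_iff]
  intro m
  have hi : StrictMono (fun j => Nat.pair m (j+1)) :=
    strictMono_nat_of_lt_succ fun j => Nat.pair_lt_pair_right m (Nat.lt_succ_self _)
  filter_upwards [slln hi (s := fun _ _ => True) (fun _ _ _ _ => Iff.rfl)] with x hx
  by_contra hc
  push Not at hc
  simp only [hc, if_true, Finset.sum_const, Finset.card_range] at hx
  have h2 : Tendsto (fun n : ℕ => (n • (1/2:ℝ)) / n) atTop (nhds (1/2)) := by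
    refine tendsto_const_nhds.congr' ?_
    filter_upwards [eventually_gt_atTop 0] with n hn
    have : (n:ℝ) ≠ 0 := by positivity
    simp; field_simp
  have := tendsto_nhds_unique hx h2
  norm_num at this

/-- one step sample -/
noncomputable def Y (k : Fin 5) (a : Fin 2) (u : ℝ) : Fin 5 × Fin 2 := sampleOn (qex k a) u

lemma qex_half (k : Fin 5) (a : Fin 2) (y : Fin 5 × Fin 2) : ∃ n : ℕ, qex k a y = n / 2 := by
  have h0 : ∃ n : ℕ, (0:ℝ) = n / 2 := ⟨0, by simp⟩
  have h1 : ∃ n : ℕ, (1/2:ℝ) = n / 2 := ⟨1, by simp⟩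
  have h2 : ∃ n : ℕ, (1:ℝ) = n / 2 := ⟨2, by simp⟩
  unfold qex
  split_ifs <;> assumption

lemma qex_sum (k : Fin 5) (a : Fin 2) : ∑ y, qex k a y = 1 := Γex.q_sum k a

lemma Y_pos (k : Fin 5) (a : Fin 2) (u : ℝ) (h0 : 0 ≤ u) (h1 : u < 1) :
    0 < qex k a (Y k a u) := by
  obtain ⟨L, hL⟩ := sampleOn_spec (qex k a) (qex_sum k a)
  have := hL u h0 h1
  unfold Y
  linarith

lemma Y_ne (k : Fin 5) (a : Fin 2) (h : ∀ y, qex k a y ≤ 1/2) : Y k a 0 ≠ Y k a (1/2) := by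
  obtain ⟨L, hL⟩ := sampleOn_spec (qex k a) (qex_sum k a)
  intro e
  have h1 := hL 0 le_rfl (by norm_num)
  have h2 := hL (1/2) (by norm_num) (by norm_num)
  unfold Y at e
  rw [← e] at h2
  have := h (sampleOn (qex k a) 0)
  linarith

def IsBit (u : ℝ) : Prop := u = 0 ∨ u = 1/2

lemma IsBit.lt {u : ℝ} (h : IsBit u) : 0 ≤ u ∧ u < 1 := by rcases h with rfl | rfl <;> norm_num

lemma Y0 (a : Fin 2) {u : ℝ} (h : IsBit u) : Y 0 a u = (1,1) ∨ Y 0 a u = (3,0) := by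
  have := Y_pos 0 a u h.lt.1 h.lt.2
  by_contra hc
  push Not at hc
  simp [qex, hc] at this

lemma Y10 {u : ℝ} (h : IsBit u) : Y 1 0 u = (1,0) ∨ Y 1 0 u = (2,1) := by
  have := Y_pos 1 0 u h.lt.1 h.lt.2
  by_contra hc
  push Not at hc
  simp [qex, hc] at this

lemma Y11 {u : ℝ} (h : IsBit u) : Y 1 1 u = (4,0) := by
  have := Y_pos 1 1 u h.lt.1 h.lt.2
  by_contra hc
  simp [qex, hc] at this

lemma Y20 {u : ℝ} (h : IsBit u) : Y 2 0 u = (4,0) := by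
  have := Y_pos 2 0 u h.lt.1 h.lt.2
  by_contra hc
  simp [qex, hc] at this

lemma Y21 {u : ℝ} (h : IsBit u) : Y 2 1 u = (1,0) := by
  have := Y_pos 2 1 u h.lt.1 h.lt.2
  by_contra hc
  simp [qex, hc] at this

lemma Y30 {u : ℝ} (h : IsBit u) : (Y 3 0 u).1 = 3 := by
  have := Y_pos 3 0 u h.lt.1 h.lt.2
  by_contra hc
  have h1 : Y 3 0 u ≠ (3,0) := fun e => hc (by rw [e])
  have h2 : Y 3 0 u ≠ (3,1) := fun e => hc (by rw [e])
  simp [qex, h1, h2] at this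

lemma Y4 (a : Fin 2) {u : ℝ} (h : IsBit u) : Y 4 a u = (4,0) := by
  have := Y_pos 4 a u h.lt.1 h.lt.2
  by_contra hc
  simp [qex, hc] at this

lemma Y0_act (a : Fin 2) (u : ℝ) : Y 0 a u = Y 0 0 u := by
  unfold Y
  congr 1

lemma Y0_ne : Y 0 0 0 ≠ Y 0 0 (1/2) := by
  apply Y_ne
  intro y
  simp only [qex]
  split_ifs <;> norm_num

lemma Y1_ne : Y 1 0 0 ≠ Y 1 0 (1/2) := by
  apply Y_ne
  intro y
  simp only [qex]
  split_ifs <;> norm_num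

noncomputable def trajE (σ : List (Fin 2 × Fin 2) → Fin 2) (e : ℕ → ℝ) :
    ℕ → Fin 5 × List (Fin 2 × Fin 2)
  | 0 => (0, [])
  | m + 1 =>
    ((Y (trajE σ e m).1 (σ (trajE σ e m).2) (e m)).1,
      (trajE σ e m).2 ++ [(σ (trajE σ e m).2, (Y (trajE σ e m).1 (σ (trajE σ e m).2) (e m)).2)])

open Classical in
noncomputable def bits (x : ℝ) (m : ℕ) : ℝ := if digitR x (Nat.pair m 0) = 1 then 1/2 else 0

lemma bits_isBit (x : ℝ) (m : ℕ) : IsBit (bits x m) := by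
  unfold bits IsBit; split_ifs <;> simp

lemma Y_good {x : ℝ} (hx : Good x) (k : Fin 5) (a : Fin 2) (m : ℕ) :
    Y k a (unif x m) = Y k a (bits x m) := by
  obtain ⟨h0, h1, h2⟩ := unif_good hx m
  unfold Y
  rw [sampleOn_canon _ (qex_half k a) _ h0 h1]
  unfold bits
  by_cases h : digitR x (Nat.pair m 0) = 1
  · rw [if_neg (by rw [h2]; simpa using h), if_pos h]
  · rw [if_pos (by rw [h2]; simpa using h), if_neg h]

lemma traj_eq {x : ℝ} (hx : Good x) (σ : Γex.Strategy) (m : ℕ) :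
    Γex.traj σ ((0 : Fin 5), x) m = trajE σ (bits x) m := by
  induction m with
  | zero => rfl
  | succ m ih =>
    let τ : List (Fin 2 × Fin 2) → Fin 2 := σ
    let F : Fin 5 × List (Fin 2 × Fin 2) → ℝ → Fin 5 × List (Fin 2 × Fin 2) := fun p u =>
      ((Y p.1 (τ p.2) u).1, p.2 ++ [(τ p.2, (Y p.1 (τ p.2) u).2)])
    have h1 : Γex.traj σ ((0 : Fin 5), x) (m+1) = F (Γex.traj σ ((0 : Fin 5), x) m) (unif x m) := rfl
    have h2 : trajE σ (bits x) (m+1) = F (trajE σ (bits x) m) (bits x m) := rfl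
    have h3 : ∀ p, F p (unif x m) = F p (bits x m) := by
      intro p; simp only [F, Y_good hx]
    exact h1.trans ((congrArg (fun p => F p (unif x m)) ih).trans ((h3 _).trans h2.symm))

noncomputable def RR (σ : List (Fin 2 × Fin 2) → Fin 2) (e : ℕ → ℝ) (n : ℕ) : ℝ :=
  ∑ m ∈ Finset.range n, gex (trajE σ e m).1 0

lemma avg_eq {x : ℝ} (hx : Good x) (σ : Γex.Strategy) :
    Γex.avg σ ((0 : Fin 5), x) = fun n => RR σ (bits x) n / n := by
  ext n
  have h : ∀ m, Γex.rew σ ((0 : Fin 5), x) m = gex (trajE σ (bits x) m).1 0 := by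
    intro m
    rw [← traj_eq hx]
    rfl
  unfold POMDP.avg RR
  simp only [h]
  ring

lemma trajE_congr (σ : List (Fin 2 × Fin 2) → Fin 2) {e e' : ℕ → ℝ} (m : ℕ)
    (h : ∀ l < m, e l = e' l) : trajE σ e m = trajE σ e' m := by
  induction m with
  | zero => rfl
  | succ m ih =>
    have := ih (fun l hl => h l (by omega))
    simp only [trajE, this, h m (by omega)]

lemma trajE_dep (σ : List (Fin 2 × Fin 2) → Fin 2) (m : ℕ) :
    Dep (Nat.pair m 0) (fun x => (trajE σ (bits x) m).1 = 1) := by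
  intro x y h
  have : trajE σ (bits x) m = trajE σ (bits y) m := by
    apply trajE_congr
    intro l hl
    unfold bits
    rw [digit_eq_of_floor (Nat.pair_lt_pair_left 0 hl) h]
  simp only [this]
abbrev Str := List (Fin 2 × Fin 2) → Fin 2

noncomputable def tval (u : ℝ) : ℝ := if Y 1 0 u = (2,1) then 1/2 else -(1/2)

noncomputable def XX (σ : Str) (e : ℕ → ℝ) (n : ℕ) : ℝ :=
  ∑ m ∈ Finset.range n, if (trajE σ e m).1 = 1 then tval (e m) else 0

lemma tval_neg : tval 0 = - tval (1/2) := by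
  have h0 := Y10 (u := 0) (Or.inl rfl)
  have h1 := Y10 (u := 1/2) (Or.inr rfl)
  have hn := Y1_ne
  unfold tval
  rcases h0 with h0 | h0 <;> rcases h1 with h1 | h1 <;> rw [h0, h1] at hn ⊢ <;> first | exact absurd rfl hn | norm_num

lemma ae_XX (σ : Str) : ∀ᵐ x ∂mu, Tendsto (fun n : ℕ => XX σ (bits x) n / n) atTop (nhds 0) := by
  classical
  have hi : StrictMono (fun m => Nat.pair m 0) :=
    strictMono_nat_of_lt_succ fun m => Nat.pair_lt_pair_left 0 (Nat.lt_succ_self _)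
  filter_upwards [slln hi (s := fun _ _ => True) (fun _ _ _ _ => Iff.rfl),
    slln hi (s := fun m x => (trajE σ (bits x) m).1 = 1) (fun m => trajE_dep σ m)] with x h1 h2
  have h3 := (h1.add h2).const_mul (tval (1/2))
  simp only [add_zero, mul_zero] at h3
  refine h3.congr fun n => ?_
  rw [← add_div, ← Finset.sum_add_distrib, mul_div_assoc', Finset.mul_sum]
  congr 1
  unfold XX
  apply Finset.sum_congr rfl
  intro m _
  have hb : bits x m = if digitR x (Nat.pair m 0) = 1 then 1/2 else 0 := by
    unfold bits; congr
  rw [hb]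
  by_cases hc : (trajE σ (bits x) m).1 = 1 <;> by_cases hd : digitR x (Nat.pair m 0) = 1 <;>
    simp only [hc, hd, if_true, if_false, tval_neg, iff_self, iff_false, iff_true, not_true_eq_false] <;>
    ring

lemma trajE_succ (σ : Str) (e : ℕ → ℝ) (m : ℕ) : trajE σ e (m+1) =
    ((Y (trajE σ e m).1 (σ (trajE σ e m).2) (e m)).1,
      (trajE σ e m).2 ++ [(σ (trajE σ e m).2, (Y (trajE σ e m).1 (σ (trajE σ e m).2) (e m)).2)]) := rfl

lemma RR_succ (σ : Str) (e : ℕ → ℝ) (n : ℕ) :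
    RR σ e (n+1) = RR σ e n + gex (trajE σ e n).1 0 := Finset.sum_range_succ _ _
lemma XX_succ (σ : Str) (e : ℕ → ℝ) (n : ℕ) :
    XX σ e (n+1) = XX σ e n + if (trajE σ e n).1 = 1 then tval (e n) else 0 :=
  Finset.sum_range_succ _ _

lemma gex_nonneg (k : Fin 5) : 0 ≤ gex k 0 := by unfold gex; split_ifs <;> simp
lemma gex_le (k : Fin 5) : gex k 0 ≤ 1 := by unfold gex; split_ifs <;> simp

lemma RR_nonneg (σ : Str) (e : ℕ → ℝ) (n : ℕ) : 0 ≤ RR σ e n :=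
  Finset.sum_nonneg fun _ _ => gex_nonneg _

lemma RR_le (σ : Str) (e : ℕ → ℝ) (n : ℕ) : RR σ e n ≤ n := by
  induction n with
  | zero => simp [RR]
  | succ n ih =>
    rw [RR_succ]; push_cast
    linarith [gex_le (trajE σ e n).1]

lemma absorbed (σ : Str) (e : ℕ → ℝ) (he : ∀ m, IsBit (e m)) (N : ℕ)
    (h : (trajE σ e N).1 = 4) : Tendsto (fun n : ℕ => RR σ e n / n) atTop (nhds 0) := by
  have key : ∀ j, (trajE σ e (N+j)).1 = 4 ∧ RR σ e (N+j) ≤ N := by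
    intro j
    induction j with
    | zero => exact ⟨h, RR_le _ _ _⟩
    | succ j ih =>
      rw [← add_assoc, RR_succ, trajE_succ, ih.1, Y4 _ (he _)]
      refine ⟨rfl, ?_⟩
      have : gex 4 0 = 0 := by simp [gex]
      rw [this]; linarith [ih.2]
  refine tendsto_of_tendsto_of_tendsto_of_le_of_le' tendsto_const_nhds
    (tendsto_const_div_atTop_nhds_zero_nat (N:ℝ)) ?_ ?_
  · exact Eventually.of_forall fun n => div_nonneg (RR_nonneg _ _ _) (Nat.cast_nonneg _)
  · filter_upwards [eventually_ge_atTop N] with n hn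
    obtain ⟨j, rfl⟩ := Nat.exists_eq_add_of_le hn
    have := (key j).2
    gcongr

lemma inv_path (σ : Str) (e : ℕ → ℝ) (he : ∀ m, IsBit (e m)) (h0 : Y 0 0 (e 0) = (1,1)) (n : ℕ) :
    (trajE σ e (n+1)).1 = 4 ∨
    ((trajE σ e (n+1)).1 = 1 ∧ 3/2 * RR σ e (n+1) + XX σ e (n+1) = n) ∨
    ((trajE σ e (n+1)).1 = 2 ∧ 3/2 * RR σ e (n+1) + XX σ e (n+1) = n + 1) := by
  induction n with
  | zero =>
    right; left
    constructor
    · rw [trajE_succ]; simp only [trajE]; rw [Y0_act, h0]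
    · simp [RR, XX, trajE, gex]
  | succ n ih =>
    rw [trajE_succ σ e (n+1), RR_succ, XX_succ]
    have hb := he (n+1)
    have ha : σ (trajE σ e (n+1)).2 = 0 ∨ σ (trajE σ e (n+1)).2 = 1 := by
      generalize σ (trajE σ e (n+1)).2 = a
      revert a; decide
    rcases ih with h | ⟨h, hr⟩ | ⟨h, hr⟩
    · left; rw [h, Y4 _ hb]
    · rw [h]
      rcases ha with ha | ha <;> rw [ha]
      · right
        rcases Y10 hb with hy | hy
        · left
          rw [hy]
          refine ⟨rfl, ?_⟩
          simp [gex, tval, hy]; linarith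
        · right
          rw [hy]
          refine ⟨rfl, ?_⟩
          simp [gex, tval, hy]; linarith
      · left; rw [Y11 hb]
    · rw [h]
      rcases ha with ha | ha <;> rw [ha]
      · left; rw [Y20 hb]
      · right; left
        rw [Y21 hb]
        refine ⟨rfl, ?_⟩
        simp [gex]; linarith

lemma lim23 (σ : Str) (e : ℕ → ℝ) (he : ∀ m, IsBit (e m)) (h0 : Y 0 0 (e 0) = (1,1))
    (hX : Tendsto (fun n : ℕ => XX σ e n / n) atTop (nhds 0))
    (hn : ∀ n, (trajE σ e (n+1)).1 ≠ 4) :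
    Tendsto (fun n : ℕ => RR σ e n / n) atTop (nhds (2/3)) := by
  have h1 : Tendsto (fun n : ℕ => (3/2 * RR σ e n + XX σ e n) / n) atTop (nhds 1) := by
    have hl : Tendsto (fun n : ℕ => 1 - (1:ℝ) / n) atTop (nhds 1) := by
      simpa using (tendsto_const_nhds (x := (1:ℝ))).sub (tendsto_const_div_atTop_nhds_zero_nat (1:ℝ))
    refine tendsto_of_tendsto_of_tendsto_of_le_of_le' hl tendsto_const_nhds ?_ ?_
    all_goals
      filter_upwards [eventually_ge_atTop 1] with n hn1
      obtain ⟨k, rfl⟩ := Nat.exists_eq_add_of_le' hn1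
      have hk : (0:ℝ) < ((k+1 : ℕ) : ℝ) := by positivity
      have := inv_path σ e he h0 k
      have hnk := hn k
    · rw [le_div_iff₀ hk, sub_mul, div_mul_cancel₀ _ hk.ne']
      push_cast
      rcases this with h | ⟨_, h⟩ | ⟨_, h⟩
      · exact absurd h hnk
      · linarith
      · linarith
    · rw [div_le_iff₀ hk]
      push_cast
      rcases this with h | ⟨_, h⟩ | ⟨_, h⟩
      · exact absurd h hnk
      · linarith
      · linarith
  have h2 := (h1.sub hX).const_mul (2/3)
  simp only [sub_zero, mul_one] at h2
  refine h2.congr fun n => ?_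
  ring

lemma liminf_bd (σ : Str) (e : ℕ → ℝ) :
    0 ≤ atTop.liminf (fun n : ℕ => RR σ e n / n) ∧ atTop.liminf (fun n : ℕ => RR σ e n / n) ≤ 1 := by
  have h0 : ∀ n : ℕ, 0 ≤ RR σ e n / n := fun n => div_nonneg (RR_nonneg _ _ _) (Nat.cast_nonneg _)
  have h1 : ∀ n : ℕ, RR σ e n / n ≤ 1 := fun n =>
    div_le_one_of_le₀ (RR_le _ _ _) (Nat.cast_nonneg _)
  have b1 : IsBoundedUnder (· ≤ ·) atTop (fun n : ℕ => RR σ e n / n) :=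
    isBoundedUnder_of ⟨1, h1⟩
  have b0 : IsBoundedUnder (· ≥ ·) atTop (fun n : ℕ => RR σ e n / n) :=
    isBoundedUnder_of ⟨0, h0⟩
  constructor
  · exact le_liminf_of_le b1.isCoboundedUnder_ge (Eventually.of_forall h0)
  · refine liminf_le_of_le b0 fun b hb => ?_
    obtain ⟨n, hn⟩ := hb.exists
    exact hn.trans (h1 n)

noncomputable def FF (x : ℝ) : ℝ := if Y 0 0 (bits x 0) = (3,0) then 1 else 2/3

lemma upper (σ : Γex.Strategy) : ∀ᵐ x ∂mu,
    0 ≤ atTop.liminf (Γex.avg σ ((0:Fin 5), x)) ∧ atTop.liminf (Γex.avg σ ((0:Fin 5), x)) ≤ FF x := by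
  filter_upwards [ae_good, ae_XX σ] with x hx hX
  rw [avg_eq hx]
  have hb := liminf_bd σ (bits x)
  refine ⟨hb.1, ?_⟩
  unfold FF
  rcases Y0 0 (bits_isBit x 0) with h | h
  · rw [if_neg (by rw [h]; decide)]
    by_cases hn : ∀ n, (trajE σ (bits x) (n+1)).1 ≠ 4
    · exact (lim23 σ _ (bits_isBit x) h hX hn).liminf_eq.le
    · push Not at hn
      obtain ⟨n, hn⟩ := hn
      rw [(absorbed σ _ (bits_isBit x) _ hn).liminf_eq]
      norm_num
  · rw [if_pos h]; exact hb.2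

def sstar : Str
  | [] => 0
  | (_, s) :: t => if s = 0 then 0 else
    match t.getLast? with
    | none => 0
    | some q => q.2

lemma sstar_path1 (e : ℕ → ℝ) (he : ∀ m, IsBit (e m)) (h0 : Y 0 0 (e 0) = (1,1)) (n : ℕ) :
    (∃ t, (trajE sstar e (n+1)).2 = (0,1) :: t) ∧
    (((trajE sstar e (n+1)).1 = 1 ∧ sstar (trajE sstar e (n+1)).2 = 0) ∨
     ((trajE sstar e (n+1)).1 = 2 ∧ sstar (trajE sstar e (n+1)).2 = 1)) := by
  induction n with
  | zero =>
    rw [trajE_succ]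
    have : sstar [] = 0 := rfl
    simp only [trajE, this, h0]
    refine ⟨⟨[], rfl⟩, Or.inl ⟨trivial, ?_⟩⟩
    simp [sstar]
  | succ n ih =>
    obtain ⟨⟨t, ht⟩, ih⟩ := ih
    rw [trajE_succ sstar e (n+1)]
    have hb := he (n+1)
    have hap : ∀ q : Fin 2 × Fin 2, sstar ((0,1) :: t ++ [q]) = q.2 := by
      intro q; simp [sstar]
    refine ⟨⟨_, by rw [ht]; rfl⟩, ?_⟩
    rcases ih with ⟨h1, h2⟩ | ⟨h1, h2⟩
    · rw [h1, h2]
      simp only [ht, hap]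
      rcases Y10 hb with h | h
      · left; rw [h]; simp
      · right; rw [h]; simp
    · rw [h1, h2]
      simp only [ht, hap, Y21 hb]
      left; simp

lemma sstar_path3 (e : ℕ → ℝ) (he : ∀ m, IsBit (e m)) (h0 : Y 0 0 (e 0) = (3,0)) (n : ℕ) :
    (∃ t, (trajE sstar e (n+1)).2 = (0,0) :: t) ∧ (trajE sstar e (n+1)).1 = 3 ∧
      RR sstar e (n+1) = n := by
  induction n with
  | zero =>
    rw [trajE_succ]
    have : sstar [] = 0 := rfl
    simp only [trajE, this, h0]
    refine ⟨⟨[], rfl⟩, trivial, ?_⟩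
    simp [RR, trajE, gex]
  | succ n ih =>
    obtain ⟨⟨t, ht⟩, h, hR⟩ := ih
    rw [trajE_succ sstar e (n+1), RR_succ, h, hR]
    have hz : sstar (trajE sstar e (n+1)).2 = 0 := by rw [ht]; simp [sstar]
    refine ⟨⟨_, by rw [ht]; rfl⟩, ?_, ?_⟩
    · rw [hz]; exact Y30 (he _)
    · simp [gex]

lemma lower : ∀ᵐ x ∂mu, atTop.liminf (Γex.avg (sstar : Str) ((0:Fin 5), x)) = FF x := by
  filter_upwards [ae_good, ae_XX sstar] with x hx hX
  have e := avg_eq hx (sstar : Str)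
  rw [e]
  unfold FF
  rcases Y0 0 (bits_isBit x 0) with h | h
  · rw [if_neg (by rw [h]; decide)]
    refine (lim23 sstar _ (bits_isBit x) h hX ?_).liminf_eq
    intro n hn
    rcases (sstar_path1 _ (bits_isBit x) h n).2 with h | h <;> rw [h.1] at hn <;> revert hn <;> decide
  · rw [if_pos h]
    refine Tendsto.liminf_eq ?_
    have hl : Tendsto (fun n : ℕ => 1 - (1:ℝ) / n) atTop (nhds 1) := by
      simpa using (tendsto_const_nhds (x := (1:ℝ))).sub (tendsto_const_div_atTop_nhds_zero_nat (1:ℝ))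
    refine hl.congr' ?_
    filter_upwards [eventually_ge_atTop 1] with n hn1
    obtain ⟨k, rfl⟩ := Nat.exists_eq_add_of_le' hn1
    rw [(sstar_path3 _ (bits_isBit x) h k).2.2]
    push_cast
    have : (k:ℝ) + 1 ≠ 0 := by positivity
    field_simp
    ring

lemma FF_int : Integrable FF mu ∧ ∫ x, FF x ∂mu = 5/6 := by
  classical
  let D : Set ℝ := {x | digitR x (Nat.pair 0 0) = 1}
  have mD : MeasurableSet D := (Dep.digit _).meas
  have hD : mu.real D = 1/2 := by
    have := mu_half' (i := Nat.pair 0 0) (P := fun _ => True) (s := fun _ => True)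
      (fun _ _ _ => Iff.rfl) (fun _ _ _ => Iff.rfl)
    simp only [true_and, true_iff] at this
    have e : mu D = 1/2 := by
      rw [show D = {x | digitR x (Nat.pair 0 0) = 1} from rfl, this]; simp
    simp [Measure.real, e]
  obtain ⟨c1, c2, hc, hF⟩ : ∃ c1 c2 : ℝ, c1 + c2 = 5/3 ∧
      FF = fun x => c2 + D.indicator (fun _ => c1 - c2) x := by
    refine ⟨if Y 0 0 (1/2) = (3,0) then 1 else 2/3, if Y 0 0 0 = (3,0) then 1 else 2/3, ?_, ?_⟩
    · have hn := Y0_ne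
      rcases Y0 0 (u := 0) (Or.inl rfl) with h0 | h0 <;>
      rcases Y0 0 (u := 1/2) (Or.inr rfl) with h1 | h1 <;>
      rw [h0, h1] at hn ⊢ <;> first | exact absurd rfl hn | norm_num
    · ext x
      unfold FF bits
      by_cases h : digitR x (Nat.pair 0 0) = 1
      · rw [Set.indicator_of_mem (show x ∈ D from h), if_pos h]; ring
      · rw [Set.indicator_of_notMem (show x ∉ D from h), if_neg h]; ring
  have i1 : Integrable (D.indicator (fun _ => c1 - c2)) mu := (integrable_const _).indicator mD
  rw [hF]
  refine ⟨(integrable_const _).add i1, ?_⟩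
  rw [integral_add (integrable_const _) i1, integral_indicator_const _ mD, hD]
  simp
  linarith

lemma pay_eq (σ : Γex.Strategy) : Γex.pay (diracBelief (0 : Fin 5)) σ =
    ∫ x, atTop.liminf (Γex.avg σ ((0:Fin 5), x)) ∂mu := by
  have h : Γex.envMeasure (diracBelief (0 : Fin 5)) = Measure.map (Prod.mk (0 : Fin 5)) mu := by
    have hv : vecMeasure (diracBelief (0 : Fin 5)) = Measure.dirac (0 : Fin 5) := by
      simp [vecMeasure, diracBelief, Fin.sum_univ_five]
    rw [← Measure.dirac_prod, ← hv]
    rfl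
  unfold POMDP.pay
  rw [h]
  exact (MeasurableEmbedding.prodMk_left (0 : Fin 5) MeasurableEmbedding.id).integral_map _

/-- The value of the example POMDP `Γex` starting from `k₀` is `5/6`. -/
theorem gammaEx_val : Γex.val (diracBelief (0 : Fin 5)) = 5 / 6 := by
  have ub : ∀ σ : Γex.Strategy, Γex.pay (diracBelief (0 : Fin 5)) σ ≤ 5/6 := by
    intro σ
    rw [pay_eq, ← FF_int.2]
    exact integral_mono_of_nonneg ((upper σ).mono fun x h => h.1) FF_int.1
      ((upper σ).mono fun x h => h.2)
  unfold POMDP.val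
  apply le_antisymm
  · exact ciSup_le ub
  · refine le_ciSup_of_le ⟨5/6, ?_⟩ (sstar : Str) ?_
    · rintro _ ⟨σ, rfl⟩; exact ub σ
    · have h := pay_eq (sstar : Str)
      rw [integral_congr_ae lower, FF_int.2] at h
      exact h.ge

end PomdpPaper
end
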